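/- arXiv:math/0604502 — 4 statements merged into one kernel-verified Lean document; each statement's English description precedes it below -/
import Mathlib

section
/- Let p = (x_p, y_p), q = (x_q, y_q), r = (x_r, y_r) be three points of (ℝ/ℤ)² which are generic in the sense that each of the six triples appearing in P_0, P_1, P_2 below consists of pairwise distinct elements of ℝ/ℤ. Consider the three pairs of triples P_0 = ((x_p, x_q, x_r), (y_p, y_q, y_r)), P_1 = ((−x_p, −x_q, −x_r), (y_p−x_p, y_q−x_q, y_r−x_r)), P_2 = ((x_p−y_p, x_q−y_q, x_r−y_r), (−y_p, −y_q, −y_r)), and for j = 0, 1, 2 let S_j be the condition that the two triples of P_j have the same cyclic ordering in ℝ/ℤ. Then the number of indices j ∈ {0,1,2} for which S_j holds is even. -/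
/-!
Statement 4: Part (2) of Proposition 2.2 of "On the counting of holomorphic discs
in toric Fano manifolds" (Cho), in the angle coordinates of the Clifford torus
`(ℝ/ℤ)²`.  For three generic points `p, q, r`, among the three pairs of triples
`P₀, P₁, P₂` (the angle coordinates of `p, q, r` in the three affine charts of
`ℂP²`), the number of indices for which the two triples have the same cyclic
ordering — i.e. the total number of Maslov index 4 holomorphic discs through
`p, q, r` — is even.
-/

attribute [local instance] Classical.propDecidable

/-- The circle `ℝ/ℤ`. -/
abbrev T1 : Type := AddCircle (1 : ℝ)

/-- `(a, b, c)` is counterclockwise on `ℝ/ℤ`: there are real representatives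
`ã < b̃ < c̃ < ã + 1`. -/
def CCWc (a b c : T1) : Prop :=
  ∃ x y z : ℝ, x < y ∧ y < z ∧ z < x + 1 ∧
    (x : T1) = a ∧ (y : T1) = b ∧ (z : T1) = c

/-- The triples `(a,b,c)` and `(a',b',c')` of `ℝ/ℤ` have the same cyclic
ordering: both counterclockwise, or both clockwise. -/
def SameCyc (a b c a' b' c' : T1) : Prop :=
  (CCWc a b c ∧ CCWc a' b' c') ∨ (CCWc a c b ∧ CCWc a' c' b')

/-- `a, b, c` are pairwise distinct. -/
def Distinct3 (a b c : T1) : Prop := a ≠ b ∧ b ≠ c ∧ a ≠ c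

/-- Genericity: all six triples appearing in `P₀, P₁, P₂` consist of pairwise
distinct elements of `ℝ/ℤ`. -/
def Generic (p q r : T1 × T1) : Prop :=
  Distinct3 p.1 q.1 r.1 ∧ Distinct3 p.2 q.2 r.2 ∧
  Distinct3 (-p.1) (-q.1) (-r.1) ∧ Distinct3 (p.2 - p.1) (q.2 - q.1) (r.2 - r.1) ∧
  Distinct3 (p.1 - p.2) (q.1 - q.2) (r.1 - r.2) ∧ Distinct3 (-p.2) (-q.2) (-r.2)

/-- `S₀`: the two triples of `P₀` have the same cyclic ordering. -/
def S0 (p q r : T1 × T1) : Prop :=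
  SameCyc p.1 q.1 r.1 p.2 q.2 r.2

/-- `S₁`: the two triples of `P₁` have the same cyclic ordering. -/
def S1 (p q r : T1 × T1) : Prop :=
  SameCyc (-p.1) (-q.1) (-r.1) (p.2 - p.1) (q.2 - q.1) (r.2 - r.1)

/-- `S₂`: the two triples of `P₂` have the same cyclic ordering. -/
def S2 (p q r : T1 × T1) : Prop :=
  SameCyc (p.1 - p.2) (q.1 - q.2) (r.1 - r.2) (-p.2) (-q.2) (-r.2)

theorem T1.exists_coe_eq_and_mem_Ico (a : T1) (x : ℝ) :
    ∃ y : ℝ, x ≤ y ∧ y < x + 1 ∧ (y : T1) = a := by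
  have : Fact ((0 : ℝ) < 1) := ⟨one_pos⟩
  refine ⟨AddCircle.equivIco 1 x a, (AddCircle.equivIco 1 x a).2.1,
    (AddCircle.equivIco 1 x a).2.2, ?_⟩
  exact (AddCircle.equivIco 1 x).symm_apply_apply a

theorem T1.coe_eq_coe_iff (x y : ℝ) : (x : T1) = y ↔ ∃ n : ℤ, x = y + n := by
  rw [eq_comm, QuotientAddGroup.eq, AddSubgroup.mem_zmultiples_iff]
  refine exists_congr fun n => ?_
  rw [zsmul_one]
  constructor <;> intro h <;> linarith

theorem CCWc.neg {a b c : T1} (h : CCWc a b c) : CCWc (-a) (-c) (-b) := by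
  obtain ⟨x, y, z, hxy, hyz, hzx, rfl, rfl, rfl⟩ := h
  have coe_one_sub (t : ℝ) : ((1 - t : ℝ) : T1) = -(t : T1) := by
    rw [← AddCircle.coe_neg, T1.coe_eq_coe_iff]
    exact ⟨1, by push_cast; ring⟩
  exact ⟨-x, 1 - z, 1 - y, by linarith, by linarith, by linarith,
    AddCircle.coe_neg _, coe_one_sub z, coe_one_sub y⟩

theorem CCWc.neg_iff {a b c : T1} : CCWc (-a) (-b) (-c) ↔ CCWc a c b :=
  ⟨fun h => by simpa using h.neg, CCWc.neg⟩

theorem CCWc.not_swap {a b c : T1} (h : CCWc a b c) : ¬ CCWc a c b := by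
  obtain ⟨x, y, z, hxy, hyz, hzx, rfl, rfl, rfl⟩ := h
  rintro ⟨x', z', y', hxz, hzy, hyx, hx, hz, hy⟩
  rw [T1.coe_eq_coe_iff] at hx hy hz
  obtain ⟨l, rfl⟩ := hx
  obtain ⟨m, rfl⟩ := hy
  obtain ⟨n, rfl⟩ := hz
  have hln : (l : ℝ) < n + 1 := by linarith
  have hnm : (n : ℝ) < m := by linarith
  have hml : (m : ℝ) < l + 1 := by linarith
  norm_cast at hln hnm hml
  omega

theorem Distinct3.ccwc_or_ccwc_swap {a b c : T1} (h : Distinct3 a b c) :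
    CCWc a b c ∨ CCWc a c b := by
  obtain ⟨x, -, -, rfl⟩ := T1.exists_coe_eq_and_mem_Ico a 0
  obtain ⟨y, hxy, hyx, rfl⟩ := T1.exists_coe_eq_and_mem_Ico b x
  obtain ⟨z, hxz, hzx, rfl⟩ := T1.exists_coe_eq_and_mem_Ico c x
  obtain ⟨hab, hbc, hac⟩ := h
  have hxy' : x < y := hxy.lt_of_ne fun e => hab (e ▸ rfl)
  have hxz' : x < z := hxz.lt_of_ne fun e => hac (e ▸ rfl)
  rcases lt_trichotomy y z with hyz | rfl | hzy
  · exact Or.inl ⟨x, y, z, hxy', hyz, hzx, rfl, rfl, rfl⟩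
  · exact absurd rfl hbc
  · exact Or.inr ⟨x, z, y, hxz', hzy, hyx, rfl, rfl, rfl⟩

theorem Distinct3.ccwc_swap_iff {a b c : T1} (h : Distinct3 a b c) :
    CCWc a c b ↔ ¬ CCWc a b c :=
  ⟨fun hs hc => hc.not_swap hs, h.ccwc_or_ccwc_swap.resolve_left⟩

theorem total_number_of_maslov_four_discs_is_even
    (p q r : T1 × T1) (hgen : Generic p q r) :
    Even ((if S0 p q r then 1 else 0) + (if S1 p q r then 1 else 0)
      + (if S2 p q r then 1 else 0) : ℕ) := by
  obtain ⟨hx, hy, -, hyx, -, -⟩ := hgen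
  have h₀ : S0 p q r ↔ (CCWc p.1 q.1 r.1 ↔ CCWc p.2 q.2 r.2) := by
    rw [S0, SameCyc, hx.ccwc_swap_iff, hy.ccwc_swap_iff]
    tauto
  have h₁ : S1 p q r ↔
      (¬ CCWc p.1 q.1 r.1 ↔ CCWc (p.2 - p.1) (q.2 - q.1) (r.2 - r.1)) := by
    rw [S1, SameCyc, CCWc.neg_iff, CCWc.neg_iff, hx.ccwc_swap_iff, hyx.ccwc_swap_iff]
    tauto
  have h₂ : S2 p q r ↔
      (CCWc (p.2 - p.1) (q.2 - q.1) (r.2 - r.1) ↔ CCWc p.2 q.2 r.2) := by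
    rw [S2, ← neg_sub p.2 p.1, ← neg_sub q.2 q.1, ← neg_sub r.2 r.1, SameCyc]
    simp only [CCWc.neg_iff, hy.ccwc_swap_iff, hyx.ccwc_swap_iff]
    tauto
  by_cases hcx : CCWc p.1 q.1 r.1 <;> by_cases hcy : CCWc p.2 q.2 r.2 <;>
    by_cases hcyx : CCWc (p.2 - p.1) (q.2 - q.1) (r.2 - r.1) <;>
    simp [h₀, h₁, h₂, hcx, hcy, hcyx]
end

section
/- Let Δ ⊂ (ℝ/ℤ)² be the image of the triangle {(s,t) ∈ ℝ² : 0 ≤ s ≤ t ≤ 1} under the projection ℝ² → (ℝ/ℤ)², and for x ∈ (ℝ/ℤ)² set Q_x = x + Δ. For p, q, r ∈ (ℝ/ℤ)², define T_pqr ∈ {0,1,2,3} as the number of true statements among: (r ∈ Q_p and r ∈ Q_q), (q ∈ Q_p and q ∈ Q_r), (p ∈ Q_q and p ∈ Q_r); and let N_cyc(p,q,r) be the number of indices j ∈ {0,1,2} such that both triples of the pair P_j are counterclockwise. Then the residue (N_cyc(p,q,r) + T_pqr) mod 2 is the same for all strongly generic triples (p, q, r); i.e. the mod 2 count of cyclically-ordered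 holomorphic discs corrected by T_pqr is an invariant, independent of the choice of the three generic points. -/
/-!
Statement 6: Part (4) of Proposition 2.2 of "On the counting of holomorphic discs
in toric Fano manifolds" (Cho), in the angle coordinates of the Clifford torus
`(ℝ/ℤ)²`.  Correcting the count `N_cyc(p,q,r)` of cyclically-ordered Maslov
index 4 holomorphic discs through `p, q, r` by the triple intersection number
`T_pqr` with the 2-chains `Q_x = x + Δ` yields a mod 2 invariant, independent of
the choice of the strongly generic triple `(p, q, r)`.
-/

attribute [local instance] Classical.propDecidable

/-- `d` avoids the three lines `{x = 0}`, `{y = 0}`, `{x = y}` of `(ℝ/ℤ)²`. -/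
def OffLines (d : T1 × T1) : Prop := d.1 ≠ 0 ∧ d.2 ≠ 0 ∧ d.1 ≠ d.2

/-- Strong genericity: genericity together with the requirement that none of the
six differences of the three points lies on the three lines. -/
def StronglyGeneric (p q r : T1 × T1) : Prop :=
  Generic p q r ∧
  OffLines (q - p) ∧ OffLines (r - p) ∧ OffLines (r - q) ∧
  OffLines (p - q) ∧ OffLines (p - r) ∧ OffLines (q - r)

/-- The triangle `Δ ⊂ (ℝ/ℤ)²`: image of `{(s,t) : 0 ≤ s ≤ t ≤ 1}` under the
projection `ℝ² → (ℝ/ℤ)²`. -/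
def Delta : Set (T1 × T1) :=
  {y | ∃ s t : ℝ, 0 ≤ s ∧ s ≤ t ∧ t ≤ 1 ∧ y = ((s : T1), (t : T1))}

/-- The translated 2-chain `Q_x = x + Δ`. -/
def Q (x : T1 × T1) : Set (T1 × T1) := {y | ∃ d ∈ Delta, y = x + d}

/-- `T_pqr`: the number of true statements among `(r ∈ Q_p ∧ r ∈ Q_q)`,
`(q ∈ Q_p ∧ q ∈ Q_r)`, `(p ∈ Q_q ∧ p ∈ Q_r)`. -/
noncomputable def Tpqr (p q r : T1 × T1) : ℕ :=
  (if r ∈ Q p ∧ r ∈ Q q then 1 else 0)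
  + (if q ∈ Q p ∧ q ∈ Q r then 1 else 0)
  + (if p ∈ Q q ∧ p ∈ Q r then 1 else 0)

/-- `N_cyc(p,q,r)`: the number of indices `j ∈ {0,1,2}` such that both triples of
the pair `P_j` are counterclockwise. -/
noncomputable def Ncyc (p q r : T1 × T1) : ℕ :=
  (if CCWc p.1 q.1 r.1 ∧ CCWc p.2 q.2 r.2 then 1 else 0)
  + (if CCWc (-p.1) (-q.1) (-r.1) ∧ CCWc (p.2 - p.1) (q.2 - q.1) (r.2 - r.1) then 1 else 0)
  + (if CCWc (p.1 - p.2) (q.1 - q.2) (r.1 - r.2) ∧ CCWc (-p.2) (-q.2) (-r.2) then 1 else 0)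

/-- The representative in `[0, 1)` of a point of the circle. -/
noncomputable def unitRep (a : T1) : ℝ := AddCircle.equivIco 1 0 a

theorem coe_unitRep (a : T1) : (unitRep a : T1) = a :=
  (AddCircle.equivIco (1 : ℝ) 0).symm_apply_apply a

theorem unitRep_nonneg (a : T1) : 0 ≤ unitRep a := (AddCircle.equivIco (1 : ℝ) 0 a).2.1

theorem unitRep_lt_one (a : T1) : unitRep a < 1 := by
  simpa [unitRep] using (AddCircle.equivIco (1 : ℝ) 0 a).2.2

theorem unitRep_eq_of_coe_eq {a : T1} {t : ℝ} (h0 : 0 ≤ t) (h1 : t < 1) (h : (t : T1) = a) :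
    unitRep a = t := by
  rw [← h, unitRep, AddCircle.equivIco_coe_eq (by simpa using ⟨h0, h1⟩)]

theorem unitRep_pos {a : T1} (h : a ≠ 0) : 0 < unitRep a := by
  refine (unitRep_nonneg a).lt_of_ne fun h0 => h ?_
  rw [← coe_unitRep a, ← h0, AddCircle.coe_zero]

theorem unitRep_ne {a b : T1} (h : a ≠ b) : unitRep a ≠ unitRep b := fun e =>
  h (by rw [← coe_unitRep a, e, coe_unitRep])

theorem unitRep_neg {a : T1} (h : a ≠ 0) : unitRep (-a) = 1 - unitRep a := by
  have := unitRep_pos h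
  have := unitRep_lt_one a
  refine unitRep_eq_of_coe_eq (by linarith) (by linarith) ?_
  rw [AddCircle.coe_sub, coe_unitRep, AddCircle.coe_period, zero_sub]

theorem unitRep_sub (a b : T1) :
    unitRep (a - b) =
      if unitRep b ≤ unitRep a then unitRep a - unitRep b else unitRep a - unitRep b + 1 := by
  have := unitRep_nonneg a
  have := unitRep_nonneg b
  have := unitRep_lt_one a
  have := unitRep_lt_one b
  split_ifs with h
  · refine unitRep_eq_of_coe_eq (by linarith) (by linarith) ?_
    rw [AddCircle.coe_sub, coe_unitRep, coe_unitRep]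
  · refine unitRep_eq_of_coe_eq (by linarith) (by linarith) ?_
    rw [AddCircle.coe_add, AddCircle.coe_sub, coe_unitRep, coe_unitRep, AddCircle.coe_period,
      add_zero]

theorem CCWc_iff_unitRep_lt {a b c : T1} (hab : b - a ≠ 0) :
    CCWc a b c ↔ unitRep (b - a) < unitRep (c - a) := by
  constructor
  · rintro ⟨x, y, z, hxy, hyz, hzx, rfl, rfl, rfl⟩
    rw [unitRep_eq_of_coe_eq (t := y - x) (by linarith) (by linarith) (AddCircle.coe_sub ..),
      unitRep_eq_of_coe_eq (t := z - x) (by linarith) (by linarith) (AddCircle.coe_sub ..)]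
    linarith
  · intro h
    have := unitRep_pos hab
    have := unitRep_lt_one (c - a)
    refine ⟨unitRep a, unitRep a + unitRep (b - a), unitRep a + unitRep (c - a),
      by linarith, by linarith, by linarith, coe_unitRep a, ?_, ?_⟩ <;>
    rw [AddCircle.coe_add, coe_unitRep, coe_unitRep, add_sub_cancel]

theorem mem_Q_iff_unitRep_le {x y : T1 × T1} (h1 : y.1 - x.1 ≠ 0) (h2 : y.2 - x.2 ≠ 0) :
    y ∈ Q x ↔ unitRep (y.1 - x.1) ≤ unitRep (y.2 - x.2) := by
  constructor
  · rintro ⟨_, ⟨s, t, hs, hst, ht, rfl⟩, rfl⟩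
    simp only [Prod.fst_add, Prod.snd_add, add_sub_cancel_left] at h1 h2 ⊢
    have ht1 : t ≠ 1 := by
      rintro rfl
      exact h2 (AddCircle.coe_period 1)
    have ht' := lt_of_le_of_ne ht ht1
    rwa [unitRep_eq_of_coe_eq hs (hst.trans_lt ht') rfl,
      unitRep_eq_of_coe_eq (hs.trans hst) ht' rfl]
  · intro h
    refine ⟨_, ⟨_, _, unitRep_nonneg _, h, (unitRep_lt_one _).le, rfl⟩, ?_⟩
    ext <;> simp [coe_unitRep]

theorem Ncyc_add_Tpqr_mod_two (p q r : T1 × T1) (h : StronglyGeneric p q r) :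
    (Ncyc p q r + Tpqr p q r) % 2 = 0 := by
  obtain ⟨-, ⟨hu1, hu2, hu⟩, ⟨hv1, hv2, hv⟩, ⟨hw1, hw2, hw⟩, -⟩ := h
  simp only [Prod.fst_sub, Prod.snd_sub] at hu1 hu2 hu hv1 hv2 hv hw1 hw2 hw
  obtain ⟨p1, p2⟩ := p
  obtain ⟨q1, q2⟩ := q
  obtain ⟨r1, r2⟩ := r
  simp only at hu1 hu2 hu hv1 hv2 hv hw1 hw2 hw
  have e1 : r1 - q1 = (r1 - p1) - (q1 - p1) := by abel
  have e2 : r2 - q2 = (r2 - p2) - (q2 - p2) := by abel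
  have e3 : p1 - q1 = -(q1 - p1) := by abel
  have e4 : p2 - q2 = -(q2 - p2) := by abel
  have e5 : p1 - r1 = -(r1 - p1) := by abel
  have e6 : p2 - r2 = -(r2 - p2) := by abel
  have e7 : q1 - r1 = -((r1 - p1) - (q1 - p1)) := by abel
  have e8 : q2 - r2 = -((r2 - p2) - (q2 - p2)) := by abel
  have d1 : -q1 - -p1 = -(q1 - p1) := by abel
  have d2 : -r1 - -p1 = -(r1 - p1) := by abel
  have d3 : q2 - q1 - (p2 - p1) = (q2 - p2) - (q1 - p1) := by abel
  have d4 : r2 - r1 - (p2 - p1) = (r2 - p2) - (r1 - p1) := by abel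
  have d5 : q1 - q2 - (p1 - p2) = (q1 - p1) - (q2 - p2) := by abel
  have d6 : r1 - r2 - (p1 - p2) = (r1 - p1) - (r2 - p2) := by abel
  have d7 : -q2 - -p2 = -(q2 - p2) := by abel
  have d8 : -r2 - -p2 = -(r2 - p2) := by abel
  rw [e1] at hw1 hw
  rw [e2] at hw2 hw
  have hu' := sub_ne_zero.2 hu
  have hu'' := sub_ne_zero.2 hu.symm
  simp only [Ncyc, Tpqr]
  rw [CCWc_iff_unitRep_lt (a := p1) (b := q1) hu1, CCWc_iff_unitRep_lt (a := p2) (b := q2) hu2,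
    CCWc_iff_unitRep_lt (a := -p1) (b := -q1) (by rwa [d1, neg_ne_zero]),
    CCWc_iff_unitRep_lt (a := p2 - p1) (b := q2 - q1) (by rwa [d3]),
    CCWc_iff_unitRep_lt (a := p1 - p2) (b := q1 - q2) (by rwa [d5]),
    CCWc_iff_unitRep_lt (a := -p2) (b := -q2) (by rwa [d7, neg_ne_zero]),
    mem_Q_iff_unitRep_le (x := (p1, p2)) (y := (r1, r2)) hv1 hv2,
    mem_Q_iff_unitRep_le (x := (q1, q2)) (y := (r1, r2)) (by rwa [e1]) (by rwa [e2]),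
    mem_Q_iff_unitRep_le (x := (p1, p2)) (y := (q1, q2)) hu1 hu2,
    mem_Q_iff_unitRep_le (x := (r1, r2)) (y := (q1, q2)) (by rwa [e7, neg_ne_zero])
      (by rwa [e8, neg_ne_zero]),
    mem_Q_iff_unitRep_le (x := (q1, q2)) (y := (p1, p2)) (by rwa [e3, neg_ne_zero])
      (by rwa [e4, neg_ne_zero]),
    mem_Q_iff_unitRep_le (x := (r1, r2)) (y := (p1, p2)) (by rwa [e5, neg_ne_zero])
      (by rwa [e6, neg_ne_zero])]
  simp only [d1, d2, d3, d4, d5, d6, d7, d8, e3, e4, e5, e6, e7, e8]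
  rw [e1, e2]
  generalize q1 - p1 = a1 at hu1 hu hw1 hw ⊢
  generalize q2 - p2 = a2 at hu2 hu hw2 hw ⊢
  generalize r1 - p1 = b1 at hv1 hv hw1 hw ⊢
  generalize r2 - p2 = b2 at hv2 hv hw2 hw ⊢
  have nu := unitRep_ne hu
  have nv := unitRep_ne hv
  have nw := unitRep_ne hw
  have n1 := unitRep_ne (sub_ne_zero.1 hw1)
  have n2 := unitRep_ne (sub_ne_zero.1 hw2)
  rw [unitRep_neg hu1, unitRep_neg hu2, unitRep_neg hv1, unitRep_neg hv2, unitRep_neg hw1,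
    unitRep_neg hw2]
  simp only [unitRep_sub] at nw ⊢
  have := unitRep_nonneg a1
  have := unitRep_lt_one a1
  have := unitRep_nonneg a2
  have := unitRep_lt_one a2
  have := unitRep_nonneg b1
  have := unitRep_lt_one b1
  have := unitRep_nonneg b2
  have := unitRep_lt_one b2
  generalize unitRep a1 = u1 at *
  generalize unitRep a2 = u2 at *
  generalize unitRep b1 = v1 at *
  generalize unitRep b2 = v2 at *
  rcases lt_or_gt_of_ne nu with a | a <;> rcases lt_or_gt_of_ne nv with b | b <;>
  rcases lt_or_gt_of_ne n1 with c | c <;> rcases lt_or_gt_of_ne n2 with d | d <;>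
  simp only [a.le, b.le, c.le, d.le, a.not_ge, b.not_ge, c.not_ge, d.not_ge, if_true, if_false]
    at nw ⊢ <;>
  rcases lt_or_gt_of_ne nw with e | e <;>
  grind

theorem corrected_disc_count_mod_two_invariant
    (p q r p' q' r' : T1 × T1)
    (h : StronglyGeneric p q r) (h' : StronglyGeneric p' q' r') :
    (Ncyc p q r + Tpqr p q r) % 2 = (Ncyc p' q' r' + Tpqr p' q' r') % 2 := by
  rw [Ncyc_add_Tpqr_mod_two p q r h, Ncyc_add_Tpqr_mod_two p' q' r' h']
end

section
/- Let A be a cyclic A_∞-algebra over a field K of characteristic 0 with operations m_k (k ≥ 1) and cyclic inner product ⟨·,·⟩. Then for every k ≥ 1 and all homogeneous x_1,…,x_{k+1} ∈ A: 0 = Σ (−1)^{Kos(σ,k_1)} ⟨m_{k_1}(x_{σ(1)},…,x_{σ(k_1)}), m_{k_2}(x_{σ(k_1+1)},…,x_{σ(k+1)})⟩, where the sum is over all cyclic permutations σ ∈ ℤ/(k+1)ℤ of the indices {1,…,k+1} and all decompositions k_1 + k_2 = k + 1 with k_1, k_2 ≥ 1, subject to the condition that 1 ∈ {σ(1),…,σ(k_1)}.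 Here (−1)^{Kos(σ,k_1)} is the Koszul sign obtained when rearranging the ordered list of symbols m, m, x_1, x_2, …, x_{k+1} into m, x_{σ(1)}, …, x_{σ(k_1)}, m, x_{σ(k_1+1)}, …, x_{σ(k+1)}, where each symbol m is treated as having degree 1 and each x_i as having degree |x_i|' (transposing two adjacent symbols of degrees d and d′ contributes the sign (−1)^{d·d′}). -/
/-- A (finite dimensional in spirit, ℤ-graded) cyclic A∞-algebra over a field `K`
of characteristic `0`.

The operations `m_k` are packaged into a single function `m : List A → A`
(`m_k` is `m` applied to lists of length `k`), multilinear in each entry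
(`m_add`, `m_smul`).  Writing `|x|` for the degree of a homogeneous element
(i.e. `x ∈ grading |x|`) and `|x|' = |x| - 1` for its shifted degree:

* `m_graded`: `m_k (x_1, …, x_k)` is homogeneous of shifted degree
  `|x_1|' + ⋯ + |x_k|' + 1`;
* `ainfty`: the A∞-equations
  `∑_{j,i} (-1)^{|x_1|'+⋯+|x_{i-1}|'} m_{k-j+1}(x_1,…,x_{i-1}, m_j(x_i,…,x_{i+j-1}),…,x_k) = 0`;
* `ip` is a nondegenerate bilinear form with graded skew symmetry
  `⟨a,b⟩ = -(-1)^{|a|'|b|'} ⟨b,a⟩` (`ip_skew`) and the cyclic symmetry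
  `⟨m_k(x_1,…,x_k), x_{k+1}⟩ = (-1)^{|x_1|'(|x_2|'+⋯+|x_{k+1}|')} ⟨m_k(x_2,…,x_{k+1}), x_1⟩`
  (`ip_cyclic`).

Elements `x_1, …, x_k` are represented by a function `x : ℕ → A` (indices `0`
through `k-1`), with degrees `d : ℕ → ℤ`; `(List.range' a b).map x` is the list
`x a, x (a+1), …, x (a+b-1)`. -/
structure CyclicAInfty (K : Type) [Field K] [CharZero K] where
  A : Type
  [instAddCommGroup : AddCommGroup A]
  [instModule : Module K A]
  grading : ℤ → Submodule K A
  m : List A → A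
  m_add : ∀ (l₁ l₂ : List A) (a b : A),
    m (l₁ ++ (a + b) :: l₂) = m (l₁ ++ a :: l₂) + m (l₁ ++ b :: l₂)
  m_smul : ∀ (l₁ l₂ : List A) (c : K) (a : A),
    m (l₁ ++ (c • a) :: l₂) = c • m (l₁ ++ a :: l₂)
  m_graded : ∀ (k : ℕ) (x : ℕ → A) (d : ℕ → ℤ), 1 ≤ k →
    (∀ i < k, x i ∈ grading (d i)) →
    m ((List.range k).map x) ∈ grading ((∑ i ∈ Finset.range k, (d i - 1)) + 2)
  ainfty : ∀ (k : ℕ) (x : ℕ → A) (d : ℕ → ℤ), 1 ≤ k →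
    (∀ i < k, x i ∈ grading (d i)) →
    ∑ j ∈ Finset.Icc 1 k, ∑ i ∈ Finset.range (k - j + 1),
      ((-1 : K) ^ (∑ s ∈ Finset.range i, (d s - 1))) •
        m ((List.range' 0 i).map x
            ++ m ((List.range' i j).map x)
              :: (List.range' (i + j) (k - i - j)).map x) = 0
  ip : A →ₗ[K] A →ₗ[K] K
  ip_nondeg : ∀ a : A, (∀ b : A, ip a b = 0) → a = 0
  ip_skew : ∀ (a b : A) (da db : ℤ), a ∈ grading da → b ∈ grading db →
    ip a b = -(((-1 : K) ^ ((da - 1) * (db - 1))) * ip b a)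
  ip_cyclic : ∀ (k : ℕ) (x : ℕ → A) (d : ℕ → ℤ), 1 ≤ k →
    (∀ i < k + 1, x i ∈ grading (d i)) →
    ip (m ((List.range k).map x)) (x k) =
      ((-1 : K) ^ ((d 0 - 1) * (∑ s ∈ Finset.Icc 1 k, (d s - 1)))) *
        ip (m ((List.range' 1 k).map x)) (x 0)

attribute [instance] CyclicAInfty.instAddCommGroup CyclicAInfty.instModule

theorem neg_one_zpow_congr {K : Type*} [Field K] {a b : ℤ} (h : Even (a - b)) :
    (-1 : K) ^ a = (-1 : K) ^ b := by
  rw [← sub_add_cancel a b, zpow_add₀ (neg_ne_zero.mpr one_ne_zero), h.neg_one_zpow, one_mul]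

theorem Finset.sum_range_add_mod {M : Type*} [AddCommMonoid M] (f : ℕ → M) (n s : ℕ) :
    ∑ t ∈ Finset.range (n + 1), f ((s + t) % (n + 1)) = ∑ t ∈ Finset.range (n + 1), f t := by
  induction s with
  | zero =>
    refine Finset.sum_congr rfl fun t ht => ?_
    rw [zero_add, Nat.mod_eq_of_lt (Finset.mem_range.mp ht)]
  | succ s ih =>
    rw [← ih, Finset.sum_range_succ, Finset.sum_range_succ' _ n]
    congr 1
    · exact Finset.sum_congr rfl fun t _ => by congr 2; ring
    · congr 1
      rw [show s + 1 + n = s + (n + 1) by ring, Nat.add_mod_right, add_zero]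

namespace CyclicAInfty

variable {K : Type} [Field K] [CharZero K] (S : CyclicAInfty K)

/-- Cyclic symmetry of `⟨m_n(y_0, …, y_{n-1}), y_n⟩` under rotation by `s` places. -/
theorem ip_rotate (n : ℕ) (hn : 1 ≤ n) (y : ℕ → S.A) (f : ℕ → ℤ)
    (hy : ∀ i < n + 1, y i ∈ S.grading (f i)) (s : ℕ) (hs : s ≤ n + 1) :
    S.ip (S.m ((List.range n).map y)) (y n) =
      (-1 : K) ^ ((∑ i ∈ Finset.range s, (f i - 1)) * ∑ i ∈ Finset.Ico s (n + 1), (f i - 1)) *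
        S.ip (S.m ((List.range n).map fun t => y ((s + t) % (n + 1))))
          (y ((s + n) % (n + 1))) := by
  induction s with
  | zero =>
    have h : (List.range n).map (fun t => y ((0 + t) % (n + 1))) = (List.range n).map y :=
      List.map_congr_left fun t ht => by
        rw [zero_add, Nat.mod_eq_of_lt (by have := List.mem_range.mp ht; omega)]
    rw [h]
    simp
  | succ s ih =>
    rw [ih (by omega), S.ip_cyclic n (fun t => y ((s + t) % (n + 1)))
      (fun t => f ((s + t) % (n + 1))) hn (fun i _ => hy _ (Nat.mod_lt _ (by omega))),
      ← mul_assoc, ← zpow_add₀ (neg_ne_zero.mpr one_ne_zero)]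
    have hlist : (List.range' 1 n).map (fun t => y ((s + t) % (n + 1))) =
        (List.range n).map fun t => y ((s + 1 + t) % (n + 1)) := by
      rw [List.range'_eq_map_range, List.map_map]
      exact List.map_congr_left fun t _ => by simp [add_assoc]
    have hlast : (s + 1 + n) % (n + 1) = (s + 0) % (n + 1) := by
      rw [show s + 1 + n = s + (n + 1) by ring, Nat.add_mod_right, add_zero]
    rw [hlist, hlast]
    congr 1
    apply neg_one_zpow_congr
    have hmod : (s + 0) % (n + 1) = s := Nat.mod_eq_of_lt (by omega)
    have htot := Finset.sum_range_add_mod (fun i => f i - 1) n s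
    rw [Finset.range_eq_Ico, Finset.sum_eq_sum_Ico_succ_bot (by omega), hmod,
      ← Finset.range_eq_Ico, ← Finset.sum_range_add_sum_Ico _ (show s ≤ n + 1 by omega),
      Finset.sum_eq_sum_Ico_succ_bot (show s < n + 1 by omega)] at htot
    rw [Finset.sum_eq_sum_Ico_succ_bot (show s < n + 1 by omega), Finset.sum_range_succ, hmod,
      show Finset.Icc 1 n = Finset.Ico (0 + 1) (n + 1) from rfl]
    generalize ∑ i ∈ Finset.range s, (f i - 1) = a at *
    generalize ∑ i ∈ Finset.Ico (s + 1) (n + 1), (f i - 1) = b at *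
    generalize ∑ i ∈ Finset.Ico (0 + 1) (n + 1), (f ((s + i) % (n + 1)) - 1) = c at *
    generalize f s - 1 = e at *
    obtain rfl : c = a + b := by linarith
    exact ⟨a * e, by ring⟩

theorem m_range'_mem (a n : ℕ) (hn : 1 ≤ n) (x : ℕ → S.A) (d : ℕ → ℤ)
    (hx : ∀ i < n, x (a + i) ∈ S.grading (d (a + i))) :
    S.m ((List.range' a n).map x) ∈ S.grading ((∑ i ∈ Finset.Ico a (a + n), (d i - 1)) + 2) := by
  have h := S.m_graded n (fun t => x (a + t)) (fun t => d (a + t)) hn hx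
  rw [Finset.sum_Ico_eq_sum_range, Nat.add_sub_cancel_left, List.range'_eq_map_range,
    List.map_map]
  exact h

/-- The summand of the cyclic identity with first block of length `p`, rotated by `r`. -/
def cyclicTerm (k : ℕ) (x : ℕ → S.A) (d : ℕ → ℤ) (p r : ℕ) : K :=
  ((-1 : K) ^
      ((∑ i ∈ Finset.range r, (d i - 1)) * (∑ i ∈ Finset.Ico r (k + 1), (d i - 1))
        + ∑ j ∈ Finset.range p, (d ((r + j) % (k + 1)) - 1))) *
    S.ip (S.m ((List.range p).map fun j => x ((r + j) % (k + 1))))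
      (S.m ((List.range (k + 1 - p)).map fun j => x ((r + p + j) % (k + 1))))

/-- Pairing a term of the A∞-equation with `x_k` gives a term of the cyclic identity. -/
theorem ip_ainfty_term (k : ℕ) (x : ℕ → S.A) (d : ℕ → ℤ)
    (hx : ∀ i < k + 1, x i ∈ S.grading (d i)) (i j : ℕ) (hj : 1 ≤ j) (hij : i + j ≤ k) :
    (-1 : K) ^ (∑ s ∈ Finset.range i, (d s - 1)) *
      S.ip (S.m ((List.range' 0 i).map x ++ S.m ((List.range' i j).map x)
        :: (List.range' (i + j) (k - i - j)).map x)) (x k) =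
      S.cyclicTerm k x d (k + 1 - j) (i + j) := by
  obtain ⟨c, rfl⟩ := Nat.exists_eq_add_of_le hij
  have hn : i + j + c + 1 - j = i + c + 1 := by omega
  have hc : i + j + c - i - j = c := by omega
  set M := S.m ((List.range' i j).map x) with hM
  let y : ℕ → S.A := fun t => if t < i then x t else if t = i then M else x (t + j - 1)
  let f : ℕ → ℤ := fun t => if t < i then d t else
    if t = i then (∑ s ∈ Finset.Ico i (i + j), (d s - 1)) + 2 else d (t + j - 1)
  have hy : ∀ t < i + c + 1 + 1, y t ∈ S.grading (f t) := by
    intro t ht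
    simp only [y, f]
    split_ifs with h1 h2
    · exact hx _ (by omega)
    · exact S.m_range'_mem i j hj x d fun s hs => hx _ (by omega)
    · exact hx _ (by omega)
  have hrot := S.ip_rotate (i + c + 1) (by omega) y f hy (i + 1) (by omega)
  have hlist : (List.range (i + c + 1)).map y =
      (List.range' 0 i).map x ++ M :: (List.range' (i + j) c).map x := by
    apply List.ext_getElem
    · simp; omega
    · intro t h1 h2
      simp only [List.getElem_map, List.getElem_range, y]
      rcases lt_trichotomy t i with h | h | h
      · rw [if_pos h, List.getElem_append_left (by simpa using h)]
        simp
      · subst h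
        simp
      · rw [if_neg (by omega), if_neg (by omega), List.getElem_append_right (by simp; omega)]
        obtain ⟨u, rfl⟩ := Nat.exists_eq_add_of_lt h
        simp only [List.length_map, List.length_range',
          show i + u + 1 - i = u + 1 by omega, List.getElem_cons_succ, List.getElem_map,
          List.getElem_range']
        congr 1
        omega
  have hlast : y (i + c + 1) = x (i + j + c) := by
    simp only [y]
    rw [if_neg (by omega), if_neg (by omega)]
    congr 1
    omega
  have hmodM : (i + 1 + (i + c + 1)) % (i + c + 1 + 1) = i := by
    rw [show i + 1 + (i + c + 1) = i + (i + c + 1 + 1) by ring, Nat.add_mod_right]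
    exact Nat.mod_eq_of_lt (by omega)
  have hyM : y i = M := by simp [y]
  have hlist₁ : (List.range (i + c + 1)).map (fun t => y ((i + 1 + t) % (i + c + 1 + 1))) =
      (List.range (i + c + 1)).map fun t => x ((i + j + t) % (i + j + c + 1)) := by
    refine List.map_congr_left fun t ht => ?_
    have ht := List.mem_range.mp ht
    rcases le_or_gt t c with h | h
    · rw [Nat.mod_eq_of_lt (by omega), Nat.mod_eq_of_lt (by omega)]
      simp only [y]
      rw [if_neg (by omega), if_neg (by omega)]
      congr 1
      omega
    · obtain ⟨u, rfl⟩ := Nat.exists_eq_add_of_lt h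
      rw [show i + 1 + (c + u + 1) = u + (i + c + 1 + 1) by ring,
        show i + j + (c + u + 1) = u + (i + j + c + 1) by ring,
        Nat.add_mod_right, Nat.add_mod_right, Nat.mod_eq_of_lt (by omega),
        Nat.mod_eq_of_lt (by omega)]
      simp only [y]
      rw [if_pos (by omega)]
  have hlist₂ : (List.range j).map
        (fun t => x ((i + j + (i + c + 1) + t) % (i + j + c + 1))) =
      (List.range' i j).map x := by
    rw [List.range'_eq_map_range, List.map_map]
    refine List.map_congr_left fun t ht => ?_
    have ht := List.mem_range.mp ht
    rw [show i + j + (i + c + 1) + t = i + t + (i + j + c + 1) by ring, Nat.add_mod_right,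
      Nat.mod_eq_of_lt (by omega)]
    rfl
  have hf₁ : ∑ t ∈ Finset.range (i + 1), (f t - 1) =
      ∑ t ∈ Finset.range (i + j), (d t - 1) + 1 := by
    rw [Finset.sum_range_succ, ← Finset.sum_range_add_sum_Ico _ (show i ≤ i + j by omega),
      Finset.sum_congr rfl (g := fun t => d t - 1)
        fun t ht => by simp [f, Finset.mem_range.mp ht]]
    simp only [f, lt_irrefl, if_false, if_true]
    ring
  have hf₂ : ∑ t ∈ Finset.Ico (i + 1) (i + c + 1 + 1), (f t - 1) =
      ∑ t ∈ Finset.Ico (i + j) (i + j + c + 1), (d t - 1) := by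
    rw [Finset.sum_Ico_eq_sum_range, Finset.sum_Ico_eq_sum_range,
      show i + c + 1 + 1 - (i + 1) = c + 1 by omega,
      show i + j + c + 1 - (i + j) = c + 1 by omega]
    refine Finset.sum_congr rfl fun t _ => ?_
    simp only [f]
    rw [if_neg (by omega), if_neg (by omega)]
    congr 2
    omega
  have hblock : ∑ t ∈ Finset.range (i + c + 1), (d ((i + j + t) % (i + j + c + 1)) - 1) =
      ∑ t ∈ Finset.Ico (i + j) (i + j + c + 1), (d t - 1) +
        ∑ t ∈ Finset.range i, (d t - 1) := by
    rw [show i + c + 1 = c + 1 + i by ring, Finset.sum_range_add,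
      Finset.sum_Ico_eq_sum_range, show i + j + c + 1 - (i + j) = c + 1 by omega]
    congr 1
    · refine Finset.sum_congr rfl fun t ht => ?_
      have ht := Finset.mem_range.mp ht
      rw [Nat.mod_eq_of_lt (by omega)]
    · refine Finset.sum_congr rfl fun t ht => ?_
      have ht := Finset.mem_range.mp ht
      rw [show i + j + (c + 1 + t) = t + (i + j + c + 1) by ring, Nat.add_mod_right,
        Nat.mod_eq_of_lt (by omega)]
  rw [hlist, hlast, hlist₁, hmodM, hyM, hf₁, hf₂] at hrot
  rw [cyclicTerm, hn, hc, hrot, show i + j + c + 1 - (i + c + 1) = j by omega, hlist₂, hblock,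
    ← hM, ← mul_assoc, ← zpow_add₀ (neg_ne_zero.mpr one_ne_zero)]
  congr 2
  ring

/-- Graded skew symmetry exchanges the two blocks when one of them starts at `x_0`. -/
theorem cyclicTerm_swap (k : ℕ) (x : ℕ → S.A) (d : ℕ → ℤ)
    (hx : ∀ i < k + 1, x i ∈ S.grading (d i)) (j : ℕ) (hj : 1 ≤ j) (hjk : j ≤ k) :
    S.cyclicTerm k x d (k + 1 - j) j = S.cyclicTerm k x d j 0 := by
  obtain ⟨c, rfl⟩ := Nat.exists_eq_add_of_le hjk
  have hhead : ∀ r : ℕ, r % (j + c + 1) = 0 → (List.range j).map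
      (fun t => x ((r + t) % (j + c + 1))) = (List.range' 0 j).map x := by
    intro r hr
    rw [List.range'_eq_map_range, List.map_map]
    refine List.map_congr_left fun t ht => ?_
    have ht := List.mem_range.mp ht
    rw [Nat.add_mod, hr, zero_add, Nat.mod_mod, Nat.mod_eq_of_lt (by omega)]
    simp
  have htail : (List.range (c + 1)).map (fun t => x ((j + t) % (j + c + 1))) =
      (List.range' j (c + 1)).map x := by
    rw [List.range'_eq_map_range, List.map_map]
    refine List.map_congr_left fun t ht => ?_
    have ht := List.mem_range.mp ht
    rw [Nat.mod_eq_of_lt (by omega)]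
    rfl
  have hblock₀ : ∑ t ∈ Finset.range j, (d ((0 + t) % (j + c + 1)) - 1) =
      ∑ t ∈ Finset.range j, (d t - 1) := by
    refine Finset.sum_congr rfl fun t ht => ?_
    have ht := Finset.mem_range.mp ht
    rw [zero_add, Nat.mod_eq_of_lt (by omega)]
  have hblock₁ : ∑ t ∈ Finset.range (c + 1), (d ((j + t) % (j + c + 1)) - 1) =
      ∑ t ∈ Finset.Ico j (j + c + 1), (d t - 1) := by
    rw [Finset.sum_Ico_eq_sum_range, show j + c + 1 - j = c + 1 by omega]
    refine Finset.sum_congr rfl fun t ht => ?_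
    have ht := Finset.mem_range.mp ht
    rw [Nat.mod_eq_of_lt (by omega)]
  have h₀ := S.m_range'_mem 0 j hj x d fun s _ => hx _ (by omega)
  have h₁ := S.m_range'_mem j (c + 1) (by omega) x d fun s _ => hx _ (by omega)
  rw [zero_add, ← Finset.range_eq_Ico] at h₀
  rw [← add_assoc] at h₁
  simp only [cyclicTerm]
  rw [show j + c + 1 - j = c + 1 by omega, show j + c + 1 - (c + 1) = j by omega,
    hhead _ (by rw [← add_assoc, Nat.mod_self]), hhead 0 (Nat.zero_mod _), zero_add, htail,
    hblock₀, hblock₁, S.ip_skew _ _ _ _ h₁ h₀, Finset.sum_range_zero, zero_mul, zero_add]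
  generalize ∑ t ∈ Finset.range j, (d t - 1) = a
  generalize ∑ t ∈ Finset.Ico j (j + c + 1), (d t - 1) = b
  rw [← neg_mul, ← mul_assoc, mul_neg, ← zpow_add₀ (neg_ne_zero.mpr one_ne_zero),
    ← neg_one_mul, ← zpow_one_add₀ (neg_ne_zero.mpr one_ne_zero)]
  congr 1
  exact neg_one_zpow_congr ⟨a * b + b + 1, by ring⟩

end CyclicAInfty

theorem exists_lt_add_mod_eq_zero_iff {k p r : ℕ} (hp : 1 ≤ p) (hpk : p ≤ k) (hr : r < k + 1) :
    (∃ j < p, (r + j) % (k + 1) = 0) ↔ r = 0 ∨ k + 1 - p + 1 ≤ r := by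
  constructor
  · rintro ⟨j, hj, h⟩
    by_contra! hcon
    rw [Nat.mod_eq_of_lt (by omega)] at h
    omega
  · rintro (rfl | h)
    · exact ⟨0, hp, by simp⟩
    · exact ⟨k + 1 - r, by omega, by rw [Nat.add_sub_cancel' hr.le, Nat.mod_self]⟩

/-- Proposition 3.4 of "On the counting of holomorphic discs in
toric Fano manifolds", Cho: the cyclic reformulation of the A∞-equations.
For homogeneous `x_0, …, x_k` (the paper's `x_1, …, x_{k+1}`, indexed here from
`0`), summing over all decompositions `k₁ + k₂ = k + 1` (`k₁, k₂ ≥ 1`) and all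
cyclic rotations `r` of the indices mod `k+1` such that the index `0` lies in
the first block, we have
`∑ (-1)^{Kos} ⟨m_{k₁}(x_{σ(1)},…,x_{σ(k₁)}), m_{k₂}(x_{σ(k₁+1)},…,x_{σ(k+1)})⟩ = 0`.

The Koszul sign of the cyclic rearrangement `m m x_0 ⋯ x_k ↦
m x_r ⋯ x_{r+k₁-1} m x_{r+k₁} ⋯ x_{r+k}` (indices mod `k+1`, each `m` of degree
`1`, each `x_i` of degree `|x_i|' = d i - 1`) is the product of the sign
`(-1)^{(|x_0|'+⋯+|x_{r-1}|')(|x_r|'+⋯+|x_k|')}` of the cyclic rotation of the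
`x`'s and the sign `(-1)^{|x_{σ(1)}|'+⋯+|x_{σ(k₁)}|'}` of moving the second `m`
past the first block. -/
theorem cyclic_ainfty_identity {K : Type} [Field K] [CharZero K]
    (S : CyclicAInfty K) (k : ℕ) (hk : 1 ≤ k) (x : ℕ → S.A) (d : ℕ → ℤ)
    (hx : ∀ i < k + 1, x i ∈ S.grading (d i)) :
    ∑ k₁ ∈ Finset.Icc 1 k, ∑ r ∈ Finset.range (k + 1),
      (if ∃ j < k₁, (r + j) % (k + 1) = 0 then
        ((-1 : K) ^
            ((∑ i ∈ Finset.range r, (d i - 1)) * (∑ i ∈ Finset.Ico r (k + 1), (d i - 1))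
              + ∑ j ∈ Finset.range k₁, (d ((r + j) % (k + 1)) - 1))) *
          S.ip (S.m ((List.range k₁).map fun j => x ((r + j) % (k + 1))))
            (S.m ((List.range (k + 1 - k₁)).map fun j => x ((r + k₁ + j) % (k + 1))))
      else 0) = 0 := by
  have hterms : ∑ j ∈ Finset.Icc 1 k, ∑ i ∈ Finset.range (k - j + 1),
      S.cyclicTerm k x d (k + 1 - j) (i + j) = 0 := by
    have h := congrArg (fun a => S.ip a (x k)) (S.ainfty k x d hk fun i hi => hx i (by omega))
    simp only [map_sum, map_smul, LinearMap.sum_apply, LinearMap.smul_apply, map_zero,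
      LinearMap.zero_apply, smul_eq_mul] at h
    rw [← h]
    refine Finset.sum_congr rfl fun j hj => Finset.sum_congr rfl fun i hi => ?_
    rw [Finset.mem_Icc] at hj
    rw [Finset.mem_range] at hi
    exact (S.ip_ainfty_term k x d hx i j hj.1 (by omega)).symm
  have hsplit : ∀ p ∈ Finset.Icc 1 k, (∑ r ∈ Finset.range (k + 1),
      if ∃ j < p, (r + j) % (k + 1) = 0 then S.cyclicTerm k x d p r else 0) =
      S.cyclicTerm k x d p 0 +
        ∑ r ∈ Finset.Ico (k + 1 - p + 1) (k + 1), S.cyclicTerm k x d p r := by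
    intro p hp
    rw [Finset.mem_Icc] at hp
    rw [← Finset.sum_filter, show (Finset.range (k + 1)).filter
        (fun r => ∃ j < p, (r + j) % (k + 1) = 0) =
        insert 0 (Finset.Ico (k + 1 - p + 1) (k + 1)) from ?_, Finset.sum_insert (by simp)]
    ext r
    simp only [Finset.mem_filter, Finset.mem_range, Finset.mem_insert, Finset.mem_Ico]
    by_cases hr : r < k + 1
    · rw [exists_lt_add_mod_eq_zero_iff hp.1 hp.2 hr]
      omega
    · omega
  have hreflect : ∑ p ∈ Finset.Icc 1 k, ∑ r ∈ Finset.Ico (k + 1 - p + 1) (k + 1),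
      S.cyclicTerm k x d p r =
      ∑ j ∈ Finset.Icc 1 k, ∑ r ∈ Finset.Ico (j + 1) (k + 1),
        S.cyclicTerm k x d (k + 1 - j) r := by
    refine Finset.sum_bij' (fun p _ => k + 1 - p) (fun j _ => k + 1 - j) ?_ ?_ ?_ ?_ ?_ <;>
      intro p hp <;> rw [Finset.mem_Icc] at hp
    · rw [Finset.mem_Icc]; omega
    · rw [Finset.mem_Icc]; omega
    · omega
    · omega
    · rw [show k + 1 - (k + 1 - p) = p by omega]
  change ∑ p ∈ Finset.Icc 1 k, ∑ r ∈ Finset.range (k + 1),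
    (if ∃ j < p, (r + j) % (k + 1) = 0 then S.cyclicTerm k x d p r else 0) = 0
  rw [Finset.sum_congr rfl hsplit, Finset.sum_add_distrib, hreflect, ← Finset.sum_add_distrib,
    ← hterms]
  refine Finset.sum_congr rfl fun j hj => ?_
  rw [Finset.mem_Icc] at hj
  rw [Finset.sum_range_succ', zero_add, S.cyclicTerm_swap k x d hx j hj.1 hj.2, add_comm,
    Finset.sum_Ico_eq_sum_range, show k + 1 - (j + 1) = k - j by omega]
  congr 1
  exact Finset.sum_congr rfl fun i _ => by congr 1; ring
end

section
/- Let R be a commutative ring containing ℚ, T ∈ R, and let A be a ℤ-graded R-module with homogeneous elements e of degree 0, f_1 and f_2 of degree 1, and f_12 of degree 2, and a bilinear map m_2 : A × A → A satisfying: m_2(e,x) = x and m_2(x,e) = (−1)^{|x|}x for all homogeneous x; m_2(f_1,f_1) = (3/2)·T·e; m_2(f_2,f_2) = (1/2)·T·e; m_2(f_1,f_2) = f_12 = −m_2(f_2,f_1); m_2(f_12,f_1) = m_2(f_1,f_12) = −(3/2)·T·f_2; m_2(f_12,f_2) = m_2(f_2,f_12) = (1/2)·T·f_1. Define the signed cyclic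 rotation t on A^{⊗3} by t(x ⊗ y ⊗ z) = (−1)^{|z|'(|x|'+|y|')} z ⊗ x ⊗ y, set N_3 = 1 + t + t², and let α = N_3(f_1 ⊗ f_1 ⊗ f_12) + 3·N_3(f_2 ⊗ f_2 ⊗ f_12) + 3T·N_3(e ⊗ f_1 ⊗ f_2) ∈ A^{⊗3}. Define m̂_2 : A^{⊗3} → A^{⊗2} on homogeneous pure tensors by m̂_2(x ⊗ y ⊗ z) = m_2(x,y) ⊗ z + (−1)^{|x|'} x ⊗ m_2(y,z). Then m̂_2(α) = 0. -/
open scoped TensorProduct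

/-- The sign `(-1)^n` for an integer `n`. -/
def sgnz (n : ℤ) : ℤ := if Even n then 1 else -1

/-- the `m₂`-part of the verification, in Proposition 5.1 of "On
the counting of holomorphic discs in toric Fano manifolds" (Cho), that the
element `α` is a cyclic cycle: with the canonical-model data of the Clifford
torus (`e` of degree `0`, `f₁, f₂` of degree `1`, `f₁₂` of degree `2`, and the
listed `m₂`-products), the element
`α = N₃(f₁ ⊗ f₁ ⊗ f₁₂) + 3·N₃(f₂ ⊗ f₂ ⊗ f₁₂) + 3T·N₃(e ⊗ f₁ ⊗ f₂) ∈ A^{⊗3}`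
satisfies `m̂₂(α) = 0` in `A^{⊗2}`.

Here `N₃ = 1 + t + t²` with
`t(x ⊗ y ⊗ z) = (-1)^{|z|'(|x|'+|y|')} z ⊗ x ⊗ y`; with the given degrees
(`|e|' = -1`, `|f₁|' = |f₂|' = 0`, `|f₁₂|' = 1`) all signs are `+1`, so
`N₃(x ⊗ y ⊗ z) = x ⊗ y ⊗ z + z ⊗ x ⊗ y + y ⊗ z ⊗ x` for each of the three
summands.  Also `m̂₂(x ⊗ y ⊗ z) = m₂(x,y) ⊗ z + (-1)^{|x|'} x ⊗ m₂(y,z)`, the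
signs `(-1)^{|x|'}` being `+1` for `x = f₁, f₂` and `-1` for `x = e, f₁₂`;
below `m̂₂` is applied termwise to `α` with these explicit signs. -/
theorem clifford_torus_cycle_m2hat_vanishes
    {R : Type} [CommRing R] [Algebra ℚ R] (T : R)
    {A : Type} [AddCommGroup A] [Module R A]
    (grading : ℤ → Submodule R A)
    (m2 : A →ₗ[R] A →ₗ[R] A)
    (e f1 f2 f12 : A)
    (he : e ∈ grading 0) (hf1 : f1 ∈ grading 1) (hf2 : f2 ∈ grading 1)
    (hf12 : f12 ∈ grading 2)
    (unit_left : ∀ (x : A) (dx : ℤ), x ∈ grading dx → m2 e x = x)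
    (unit_right : ∀ (x : A) (dx : ℤ), x ∈ grading dx → m2 x e = sgnz dx • x)
    (h11 : m2 f1 f1 = (algebraMap ℚ R (3/2) * T) • e)
    (h22 : m2 f2 f2 = (algebraMap ℚ R (1/2) * T) • e)
    (h12 : m2 f1 f2 = f12) (h21 : m2 f2 f1 = -f12)
    (h121 : m2 f12 f1 = -((algebraMap ℚ R (3/2) * T) • f2))
    (h112 : m2 f1 f12 = -((algebraMap ℚ R (3/2) * T) • f2))
    (h122 : m2 f12 f2 = (algebraMap ℚ R (1/2) * T) • f1)
    (h212 : m2 f2 f12 = (algebraMap ℚ R (1/2) * T) • f1) :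
    -- m̂₂(N₃(f₁ ⊗ f₁ ⊗ f₁₂)) :
    ((m2 f1 f1 ⊗ₜ[R] f12 + f1 ⊗ₜ[R] m2 f1 f12)
      + (m2 f12 f1 ⊗ₜ[R] f1 - f12 ⊗ₜ[R] m2 f1 f1)
      + (m2 f1 f12 ⊗ₜ[R] f1 + f1 ⊗ₜ[R] m2 f12 f1))
    -- 3 · m̂₂(N₃(f₂ ⊗ f₂ ⊗ f₁₂)) :
    + (3 : ℤ) • ((m2 f2 f2 ⊗ₜ[R] f12 + f2 ⊗ₜ[R] m2 f2 f12)
      + (m2 f12 f2 ⊗ₜ[R] f2 - f12 ⊗ₜ[R] m2 f2 f2)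
      + (m2 f2 f12 ⊗ₜ[R] f2 + f2 ⊗ₜ[R] m2 f12 f2))
    -- 3T · m̂₂(N₃(e ⊗ f₁ ⊗ f₂)) :
    + ((3 : R) * T) • ((m2 e f1 ⊗ₜ[R] f2 - e ⊗ₜ[R] m2 f1 f2)
      + (m2 f2 e ⊗ₜ[R] f1 + f2 ⊗ₜ[R] m2 e f1)
      + (m2 f1 f2 ⊗ₜ[R] e + f1 ⊗ₜ[R] m2 f2 e))
    = (0 : A ⊗[R] A) := by
  have hodd : sgnz 1 = -1 := by simp [sgnz]
  have h32 : algebraMap ℚ R (3 / 2) = 3 * algebraMap ℚ R (1 / 2) := by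
    rw [← map_ofNat (algebraMap ℚ R) 3, ← map_mul]
    norm_num
  have h_two : 2 * algebraMap ℚ R (1 / 2) = 1 := by
    rw [← map_ofNat (algebraMap ℚ R) 2, ← map_mul]
    norm_num
  rw [h11, h22, h12, h121, h112, h122, h212, unit_left f1 1 hf1,
    unit_right f2 1 hf2, hodd, h32]
  generalize algebraMap ℚ R (1 / 2) = c at h_two
  simp only [TensorProduct.tmul_neg, TensorProduct.neg_tmul, TensorProduct.tmul_smul,
    ← TensorProduct.smul_tmul', neg_smul, one_smul]
  linear_combination (norm := module) (3 * T * h_two) • (e ⊗ₜ[R] f12 - f12 ⊗ₜ[R] e)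
end
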